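/- For each integer h ≥ 1 and each complex q with |q| < 1, the generating function b̃_h(q) := Σ_{n≥0} b_h(n) q^n satisfies b̃_h(q) = (−q;q)_∞ · Σ_{j=0}^{⌈h/2⌉−1} q^{h + j(j−1)/2} C(h−j−1, j)_q Σ_{m≥0} q^{(j+1)m} / (−q^{m+1}; q)_{h−j}. -/

import Mathlib

open Finset

/-- The number of parts of the partition `P` that are greater than `j`;
this is the length of column `j` (0-indexed) of the Ferrers diagram,
i.e. the conjugate part `λ'_{j+1}`. -/
def colLen {n : ℕ} (P : Nat.Partition n) (j : ℕ) : ℕ :=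
  (P.parts.filter (fun p => j < p)).card

/-- The length of row `i` (0-indexed) of the Ferrers diagram of `P`,
i.e. the `(i+1)`-st largest part `λ_{i+1}` (or `0` if there is none). -/
def rowLen {n : ℕ} (P : Nat.Partition n) (i : ℕ) : ℕ :=
  ((Finset.range (n + 1)).filter (fun j => i < colLen P j)).card

/-- The number of cells of the Ferrers diagram of `P` whose hook number
`(λ_i − j) + (λ'_j − i) + 1` (1-indexed) equals `h`. -/
def hookCount {n : ℕ} (P : Nat.Partition n) (h : ℕ) : ℕ :=
  (((Finset.range (n + 1)) ×ˢ (Finset.range (n + 1))).filter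
    (fun ij => ij.2 < rowLen P ij.1 ∧
      rowLen P ij.1 + colLen P ij.2 = h + ij.1 + ij.2 + 1)).card

/-- `a h n`: the total number of hooks of length `h` among partitions of `n` into odd parts. -/
def hookOdd (h n : ℕ) : ℕ := ∑ P ∈ Nat.Partition.odds n, hookCount P h

/-- `b h n`: the total number of hooks of length `h` among partitions of `n` into distinct parts. -/
def hookDistinct (h n : ℕ) : ℕ := ∑ P ∈ Nat.Partition.distincts n, hookCount P h

/-- The finite q-Pochhammer symbol `(x;q)_n = ∏_{i=0}^{n−1} (1 − x qⁱ)`. -/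
def qPoch (x q : ℂ) (n : ℕ) : ℂ := ∏ i ∈ Finset.range n, (1 - x * q ^ i)

/-- The infinite product `(−q;q)_∞ = ∏_{i=1}^∞ (1 + qⁱ)`. -/
noncomputable def negqInf (q : ℂ) : ℂ := ∏' i : ℕ, (1 + q ^ (i + 1))

/-- The Gaussian binomial coefficient `C(n,k)_q = (q;q)_n / ((q;q)_k (q;q)_{n−k})`. -/
noncomputable def qBinom (n k : ℕ) (q : ℂ) : ℂ := qPoch q q n / (qPoch q q k * qPoch q q (n - k))

/-- The generating function `ã_h(q) = Σ_{n≥0} a_h(n) qⁿ`. -/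
noncomputable def atilde (h : ℕ) (q : ℂ) : ℂ := ∑' n : ℕ, (hookOdd h n : ℂ) * q ^ n

/-- The generating function `b̃_h(q) = Σ_{n≥0} b_h(n) qⁿ`. -/
noncomputable def btilde (h : ℕ) (q : ℂ) : ℂ := ∑' n : ℕ, (hookDistinct h n : ℂ) * q ^ n

section Combinatorics

variable {n : ℕ} {P : Nat.Partition n} {S : Finset ℕ}

lemma colLen_antitone (P : Nat.Partition n) : Antitone (colLen P) := by
  intro i j hij
  exact Multiset.card_le_card (Multiset.monotone_filter_right _ fun b hb => by omega)

lemma colLen_eq_zero (P : Nat.Partition n) {j : ℕ} (hj : n ≤ j) : colLen P j = 0 := by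
  rw [colLen, Multiset.card_eq_zero, Multiset.filter_eq_nil]
  intro p hp
  have := Multiset.le_sum_of_mem hp
  rw [P.parts_sum] at this
  omega

lemma lt_rowLen_iff (P : Nat.Partition n) (i j : ℕ) : j < rowLen P i ↔ i < colLen P j := by
  have hex : ∃ k, colLen P k ≤ i := ⟨n, by simp [colLen_eq_zero]⟩
  have key : ∀ j, i < colLen P j ↔ j < Nat.find hex := by
    intro j
    rw [Nat.lt_find_iff]
    exact ⟨fun h k hk => not_le.2 (h.trans_le (colLen_antitone P hk)),
      fun h => not_le.1 (h j le_rfl)⟩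
  have hle : Nat.find hex ≤ n := Nat.find_le (by simp [colLen_eq_zero])
  have : (range (n + 1)).filter (fun j => i < colLen P j) = range (Nat.find hex) := by
    ext k
    simp only [mem_filter, mem_range, key]
    omega
  rw [rowLen, this, card_range, key]

lemma colLen_eq_card (hP : P.parts = S.val.map (· + 1)) (j : ℕ) :
    colLen P j = #{e ∈ S | j ≤ e} := by
  rw [colLen, hP, Multiset.filter_map, Multiset.card_map, Finset.card_def, Finset.filter_val]
  congr 2
  ext x
  simp

lemma colLen_eq_add (hP : P.parts = S.val.map (· + 1)) {m e : ℕ} (h : m ≤ e) :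
    colLen P m = #(S ∩ Ico m e) + colLen P e := by
  rw [colLen_eq_card hP, colLen_eq_card hP, ← card_union_of_disjoint]
  · congr 1
    ext x
    simp only [mem_filter, mem_union, mem_inter, mem_Ico]
    grind
  · rw [disjoint_left]
    simp only [mem_filter, mem_inter, mem_Ico]
    grind

lemma colLen_eq_succ (hP : P.parts = S.val.map (· + 1)) (e : ℕ) :
    colLen P e = colLen P (e + 1) + if e ∈ S then 1 else 0 := by
  rw [colLen_eq_add hP (Nat.le_succ e), add_comm]
  split_ifs with h <;> simp [h]

lemma rowLen_colLen (hP : P.parts = S.val.map (· + 1)) {e : ℕ} (he : e ∈ S) :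
    rowLen P (colLen P (e + 1)) = e + 1 := by
  have h1 : e < rowLen P (colLen P (e + 1)) := by
    rw [lt_rowLen_iff, colLen_eq_succ hP e, if_pos he]
    omega
  have h2 : ¬ e + 1 < rowLen P (colLen P (e + 1)) := by simp [lt_rowLen_iff]
  omega

/-- The columns `m` in which the strict partition with parts `e + 1`, `e ∈ S`, has a cell with
leg length `j` and hook number `h`. -/
def HasHook (h j m : ℕ) (S : Finset ℕ) : Prop :=
  m + (h - j - 1) ∈ S ∧ #(S ∩ Ico m (m + (h - j - 1))) = j

instance (h j m : ℕ) (S : Finset ℕ) : Decidable (HasHook h j m S) :=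
  inferInstanceAs (Decidable (_ ∧ _))

lemma hookCount_eq (hP : P.parts = S.val.map (· + 1)) (h : ℕ) :
    hookCount P h = ∑ j ∈ range ((h + 1) / 2), #{m ∈ range (n + 1) | HasHook h j m S} := by
  rw [← card_sigma, hookCount]
  symm
  refine card_bij (fun x _ => (colLen P (x.2 + (h - x.1 - 1) + 1), x.2)) ?_ ?_ ?_
  · rintro ⟨j, m⟩ hx
    simp only [mem_sigma, mem_range, mem_filter] at hx
    obtain ⟨hj, hm, he, hc⟩ := hx
    have h1 := colLen_eq_add hP (Nat.le_add_right m (h - j - 1))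
    have h2 := colLen_eq_succ hP (m + (h - j - 1))
    rw [if_pos he] at h2
    have h3 := colLen_antitone P (Nat.zero_le (m + (h - j - 1) + 1))
    have h4 : colLen P 0 ≤ n := by
      have h5 := Multiset.card_nsmul_le_sum (s := P.parts) (a := 1)
        (fun x hx => P.parts_pos hx)
      rw [P.parts_sum] at h5
      refine (Multiset.card_le_card (Multiset.filter_le _ _)).trans (by simpa using h5)
    simp only [mem_filter, mem_product, mem_range, rowLen_colLen hP he]
    omega
  · rintro ⟨j, m⟩ hx ⟨j', m'⟩ hx' heq
    simp only [mem_sigma, mem_range, mem_filter, Prod.mk.injEq] at hx hx' heq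
    obtain ⟨h1, rfl⟩ := heq
    have h2 := rowLen_colLen hP hx.2.2.1
    rw [h1, rowLen_colLen hP hx'.2.2.1] at h2
    obtain rfl : j = j' := by omega
    rfl
  · rintro ⟨i, m⟩ hx
    simp only [mem_filter, mem_product, mem_range] at hx
    obtain ⟨⟨hi, hm⟩, hlt, hk⟩ := hx
    obtain ⟨e, he⟩ : ∃ e, rowLen P i = e + 1 := ⟨rowLen P i - 1, by omega⟩
    have h1 : i < colLen P e := by rw [← lt_rowLen_iff]; omega
    have h2 : ¬ i < colLen P (e + 1) := by rw [← lt_rowLen_iff]; omega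
    have h3 := colLen_eq_succ hP e
    have heS : e ∈ S := by
      by_contra hc
      rw [if_neg hc] at h3
      omega
    rw [if_pos heS] at h3
    have hme : m ≤ e := by omega
    have h4 := colLen_eq_add hP hme
    have h5 : #(S ∩ Ico m e) ≤ e - m :=
      (card_le_card inter_subset_right).trans (by simp)
    have h6 : m + (h - #(S ∩ Ico m e) - 1) = e := by omega
    refine ⟨⟨#(S ∩ Ico m e), m⟩, ?_, ?_⟩
    · simp only [mem_sigma, mem_range, mem_filter]
      rw [HasHook, h6]
      exact ⟨by omega, hm, heS, rfl⟩
    · simp only [h6, Prod.mk.injEq, and_true]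
      omega

/-- The finsets `S` for which the numbers `e + 1`, `e ∈ S`, form a strict partition of `n`. -/
def strictFinsets (n : ℕ) : Finset (Finset ℕ) :=
  {S ∈ (range n).powerset | ∑ e ∈ S, (e + 1) = n}

lemma mem_strictFinsets {n : ℕ} {S : Finset ℕ} :
    S ∈ strictFinsets n ↔ ∑ e ∈ S, (e + 1) = n := by
  simp only [strictFinsets, mem_filter, mem_powerset, and_iff_right_iff_imp]
  rintro h e he
  have := single_le_sum_of_canonicallyOrdered (f := fun e => e + 1) he
  rw [mem_range]
  omega

lemma hookDistinct_eq (h n : ℕ) :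
    hookDistinct h n = ∑ S ∈ strictFinsets n,
      ∑ j ∈ range ((h + 1) / 2), #{m ∈ range (n + 1) | HasHook h j m S} := by
  have key : ∀ P ∈ Nat.Partition.distincts n,
      P.parts = (P.parts.toFinset.image (· - 1)).val.map (· + 1) := by
    intro P hP
    rw [Nat.Partition.distincts, mem_filter] at hP
    rw [image_val_of_injOn, Multiset.toFinset_val, hP.2.dedup, Multiset.map_map]
    · conv_lhs => rw [← Multiset.map_id P.parts]
      refine Multiset.map_congr rfl fun x hx => ?_
      have := P.parts_pos hx
      simp only [id, Function.comp]
      omega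
    · intro a ha b hb hab
      simp only [Multiset.mem_toFinset, mem_coe] at ha hb
      have := P.parts_pos ha
      have := P.parts_pos hb
      simp only at hab
      omega
  refine sum_bij (fun P _ => P.parts.toFinset.image (· - 1)) ?_ ?_ ?_ ?_
  · intro P hP
    rw [mem_strictFinsets, Finset.sum, ← key P hP, P.parts_sum]
  · intro P hP Q hQ heq
    ext1
    rw [key P hP, key Q hQ, heq]
  · intro S hS
    rw [mem_strictFinsets] at hS
    refine ⟨⟨S.val.map (· + 1), by simp +contextual [eq_comm], hS⟩, ?_, ?_⟩
    · simp [Nat.Partition.distincts, Multiset.nodup_map_iff_inj_on, S.nodup]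
    · ext x
      simp
  · intro P hP
    exact hookCount_eq (key P hP) h

end Combinatorics

section Analysis

/-- A finset of naturals is the disjoint union of a subset of `W` and a finset disjoint from `W`. -/
def splitWindow (W : Finset ℕ) : W.powerset × {T : Finset ℕ // Disjoint T W} ≃ Finset ℕ where
  toFun p := p.1 ∪ p.2
  invFun S := (⟨S ∩ W, mem_powerset.2 inter_subset_right⟩, ⟨S \ W, sdiff_disjoint⟩)
  left_inv := by
    rintro ⟨⟨A, hA⟩, ⟨T, hT⟩⟩
    rw [mem_powerset] at hA
    rw [disjoint_left] at hT
    ext x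
    · simp only [mem_inter, mem_union]
      grind
    · simp only [mem_sdiff, mem_union]
      grind
  right_inv S := by
    ext x
    simp only [mem_inter, mem_union, mem_sdiff]
    grind

lemma tsum_window {f : ℕ → ℂ} (hf : Summable fun i => ‖f i‖) (W : Finset ℕ)
    (g : Finset ℕ → ℂ) :
    ∑' S, g (S ∩ W) * ∏ i ∈ S, f i = (∑ A ∈ W.powerset, g A * ∏ i ∈ A, f i) *
      ∑' T : {T : Finset ℕ // Disjoint T W}, ∏ i ∈ T.1, f i := by
  have hs : Summable fun T : {T : Finset ℕ // Disjoint T W} => ‖∏ i ∈ T.1, f i‖ :=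
    (summable_finsetProd_of_summable_norm hf).norm.subtype _
  rw [← sum_coe_sort W.powerset (fun A => g A * ∏ i ∈ A, f i), ← tsum_fintype (L := .unconditional _),
    tsum_mul_tsum_of_summable_norm (Summable.of_finite) hs, ← (splitWindow W).tsum_eq]
  refine tsum_congr ?_
  rintro ⟨⟨A, hA⟩, ⟨T, hT⟩⟩
  rw [mem_powerset] at hA
  have h1 : (A ∪ T) ∩ W = A := by
    rw [union_inter_distrib_right, disjoint_iff_inter_eq_empty.1 hT, union_empty, inter_eq_left.2 hA]
  simp only [splitWindow, Equiv.coe_fn_mk, h1]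
  rw [prod_union (hT.mono_right hA).symm, mul_assoc]

lemma prod_mul_tsum_window {f : ℕ → ℂ} (hf : Summable fun i => ‖f i‖) (W : Finset ℕ)
    (g : Finset ℕ → ℂ) :
    (∏ i ∈ W, (1 + f i)) * ∑' S, g (S ∩ W) * ∏ i ∈ S, f i =
      (∑ A ∈ W.powerset, g A * ∏ i ∈ A, f i) * ∏' i, (1 + f i) := by
  have h1 := tsum_window hf W 1
  simp only [Pi.one_apply, one_mul] at h1
  rw [tprod_one_add (summable_finsetProd_of_summable_norm hf), h1, tsum_window hf W g,
    prod_one_add]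
  ring

variable {q : ℂ}

lemma one_sub_pow_ne_zero (hq : ‖q‖ < 1) (i : ℕ) : 1 - q ^ (i + 1) ≠ 0 := by
  intro h
  have h1 : ‖q ^ (i + 1)‖ < 1 := by
    rw [norm_pow]
    exact pow_lt_one₀ (norm_nonneg _) hq (by omega)
  rw [← sub_eq_zero.1 h] at h1
  simp at h1

lemma one_add_pow_ne_zero (hq : ‖q‖ < 1) (i : ℕ) : 1 + q ^ (i + 1) ≠ 0 := by
  intro h
  have h1 : ‖q ^ (i + 1)‖ < 1 := by
    rw [norm_pow]
    exact pow_lt_one₀ (norm_nonneg _) hq (by omega)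
  rw [eq_neg_of_add_eq_zero_right h] at h1
  simp at h1

lemma qPoch_self_succ (q : ℂ) (n : ℕ) : qPoch q q (n + 1) = qPoch q q n * (1 - q ^ (n + 1)) := by
  rw [qPoch, prod_range_succ, qPoch, pow_succ' q n]

lemma qPoch_self_ne_zero (hq : ‖q‖ < 1) (n : ℕ) : qPoch q q n ≠ 0 := by
  refine prod_ne_zero_iff.2 fun i _ => ?_
  rw [← pow_succ']
  exact one_sub_pow_ne_zero hq i

lemma qPoch_neg_pow (q : ℂ) (m k : ℕ) :
    qPoch (-(q ^ (m + 1))) q k = ∏ i ∈ Ico m (m + k), (1 + q ^ (i + 1)) := by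
  rw [qPoch, prod_Ico_eq_prod_range, Nat.add_sub_cancel_left]
  exact prod_congr rfl fun i _ => by ring

lemma sum_powersetCard_Ico_mul (q : ℂ) (m : ℕ) : ∀ N j l : ℕ, j + l = N →
    (∑ B ∈ powersetCard j (Ico m (m + N)), ∏ i ∈ B, q ^ (i + 1)) * (qPoch q q j * qPoch q q l) =
      q ^ (j * m + j * (j + 1) / 2) * qPoch q q N := by
  intro N
  induction N with
  | zero =>
    intro j l h
    obtain ⟨rfl, rfl⟩ : j = 0 ∧ l = 0 := by omega
    simp [qPoch]
  | succ N ih =>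
    intro j l h
    obtain _ | j := j
    · obtain rfl : l = N + 1 := by omega
      simp [qPoch]
    have hnot : m + N ∉ Ico m (m + N) := by simp
    have hT : (j + 1) * (j + 1 + 1) / 2 = j * (j + 1) / 2 + (j + 1) := by
      rw [show (j + 1) * (j + 1 + 1) = j * (j + 1) + (j + 1) * 2 by ring,
        Nat.add_mul_div_right _ _ two_pos]
    have hins : (∑ B ∈ powersetCard (j + 1) (Ico m (m + (N + 1))), ∏ i ∈ B, q ^ (i + 1)) =
        (∑ B ∈ powersetCard (j + 1) (Ico m (m + N)), ∏ i ∈ B, q ^ (i + 1)) +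
          q ^ (m + N + 1) * ∑ B ∈ powersetCard j (Ico m (m + N)), ∏ i ∈ B, q ^ (i + 1) := by
      rw [← add_assoc, ← insert_Ico_right_eq_Ico_add_one (Nat.le_add_right m N),
        powersetCard_succ_insert hnot, sum_union, sum_image, mul_sum]
      · congr 1
        refine sum_congr rfl fun B hB => prod_insert fun h => hnot ?_
        exact (mem_powersetCard.1 hB).1 h
      · intro A hA B hB hAB
        have hA' : m + N ∉ A := fun h => hnot ((mem_powersetCard.1 hA).1 h)
        have hB' : m + N ∉ B := fun h => hnot ((mem_powersetCard.1 hB).1 h)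
        rw [← erase_insert hA', ← erase_insert hB', hAB]
      · rw [disjoint_left]
        intro A hA hA'
        obtain ⟨B, -, rfl⟩ := mem_image.1 hA'
        exact hnot ((mem_powersetCard.1 hA).1 (mem_insert_self _ _))
    have h2 := ih j l (by omega)
    rw [hins, hT]
    obtain _ | l := l
    · obtain rfl : N = j := by omega
      rw [powersetCard_eq_empty.2 (by simp), sum_empty, zero_add, qPoch_self_succ]
      linear_combination (q ^ (m + N + 1) * (1 - q ^ (N + 1))) * h2
    · have h1 := ih (j + 1) l (by omega)
      rw [hT] at h1
      rw [qPoch_self_succ q N]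
      rw [qPoch_self_succ q j] at h1 ⊢
      rw [qPoch_self_succ q l] at h2 ⊢
      obtain rfl : N = j + (l + 1) := by omega
      linear_combination (1 - q ^ (l + 1)) * h1 +
        (q ^ (m + (j + (l + 1)) + 1) * (1 - q ^ (j + 1))) * h2

lemma sum_powersetCard_Ico (hq : ‖q‖ < 1) (m : ℕ) {N j : ℕ} (hj : j ≤ N) :
    ∑ B ∈ powersetCard j (Ico m (m + N)), ∏ i ∈ B, q ^ (i + 1) =
      q ^ (j * m + j * (j + 1) / 2) * qBinom N j q := by
  rw [qBinom, mul_div_assoc', eq_div_iff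
    (mul_ne_zero (qPoch_self_ne_zero hq _) (qPoch_self_ne_zero hq _))]
  exact sum_powersetCard_Ico_mul q m N j (N - j) (by omega)

lemma summable_norm_pow_succ (hq : ‖q‖ < 1) : Summable fun i : ℕ => ‖q ^ (i + 1)‖ := by
  simp only [norm_pow]
  exact (summable_nat_add_iff 1).2 (summable_geometric_of_lt_one (norm_nonneg _) hq)

/-- The contribution of the strict partition encoded by `S` to the generating function of cells
in column `m` with leg length `j` and hook number `h`. -/
noncomputable def hookTerm (h : ℕ) (q : ℂ) (j m : ℕ) (S : Finset ℕ) : ℂ :=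
  if HasHook h j m S then ∏ i ∈ S, q ^ (i + 1) else 0

lemma tsum_hookTerm (hq : ‖q‖ < 1) {h j : ℕ} (hj : 2 * j + 1 ≤ h) (m : ℕ) :
    ∑' S, hookTerm h q j m S = negqInf q * (q ^ (h + j * (j - 1) / 2) * qBinom (h - j - 1) j q *
      (q ^ ((j + 1) * m) / qPoch (-(q ^ (m + 1))) q (h - j))) := by
  obtain ⟨N, hN⟩ : ∃ N, h - j = N + 1 := ⟨h - j - 1, by omega⟩
  have hN' : h - j - 1 = N := by omega
  have hnot : m + N ∉ Ico m (m + N) := by simp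
  have hW : Ico m (m + (N + 1)) = insert (m + N) (Ico m (m + N)) := by
    rw [← add_assoc, insert_Ico_right_eq_Ico_add_one (Nat.le_add_right m N)]
  have key := prod_mul_tsum_window (summable_norm_pow_succ hq) (Ico m (m + (N + 1)))
    (fun A => if m + N ∈ A ∧ #(A ∩ Ico m (m + N)) = j then 1 else 0)
  have hl : ∀ S : Finset ℕ, (if m + N ∈ S ∩ Ico m (m + (N + 1)) ∧
      #(S ∩ Ico m (m + (N + 1)) ∩ Ico m (m + N)) = j then (1 : ℂ) else 0) *
      ∏ i ∈ S, q ^ (i + 1) = hookTerm h q j m S := by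
    intro S
    have h1 : S ∩ Ico m (m + (N + 1)) ∩ Ico m (m + N) = S ∩ Ico m (m + N) := by
      rw [inter_assoc, inter_eq_right.2 (Ico_subset_Ico_right (by omega))]
    have h2 : m + N ∈ Ico m (m + (N + 1)) := by simp
    simp only [hookTerm, HasHook, hN', h1, mem_inter, h2, and_true, ite_mul, one_mul, zero_mul]
  have hr : (∑ A ∈ (Ico m (m + (N + 1))).powerset,
      (if m + N ∈ A ∧ #(A ∩ Ico m (m + N)) = j then (1 : ℂ) else 0) * ∏ i ∈ A, q ^ (i + 1)) =
      q ^ (m + N + 1) * (q ^ (j * m + j * (j + 1) / 2) * qBinom N j q) := by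
    rw [hW, sum_powerset_insert hnot, sum_eq_zero, zero_add,
      ← sum_powersetCard_Ico hq m (show j ≤ N by omega), powersetCard_eq_filter, sum_filter,
      mul_sum]
    · refine sum_congr rfl fun A hA => ?_
      rw [mem_powerset] at hA
      have h1 : insert (m + N) A ∩ Ico m (m + N) = A := by
        rw [insert_inter_of_notMem hnot, inter_eq_left.2 hA]
      rw [h1, prod_insert fun h => hnot (hA h)]
      simp
    · intro A hA
      rw [if_neg fun h => hnot (mem_powerset.1 hA h.1), zero_mul]
  simp only [hl, hr] at key
  have hne : ∏ i ∈ Ico m (m + (N + 1)), (1 + q ^ (i + 1)) ≠ 0 :=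
    prod_ne_zero_iff.2 fun i _ => one_add_pow_ne_zero hq i
  have hexp : m + N + 1 + (j * m + j * (j + 1) / 2) = h + j * (j - 1) / 2 + (j + 1) * m := by
    have hT : j * (j + 1) / 2 = j * (j - 1) / 2 + j := by
      rw [show j * (j + 1) = j * (j - 1) + j * 2 by cases j <;> simp; ring,
        Nat.add_mul_div_right _ _ two_pos]
    have : (j + 1) * m = j * m + m := by ring
    omega
  rw [hN', qPoch_neg_pow, hN, mul_div_assoc', mul_div_assoc', eq_div_iff hne, mul_comm, key,
    negqInf, ← mul_assoc, ← pow_add, hexp, pow_add]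
  ring

lemma summable_hookTerm (hq : ‖q‖ < 1) (h j : ℕ) :
    Summable fun p : ℕ × Finset ℕ => hookTerm h q j p.1 p.2 := by
  set s := √‖q‖
  have hs0 : 0 ≤ s := Real.sqrt_nonneg _
  have hs1 : s < 1 := (Real.sqrt_lt' one_pos).2 (by rwa [one_pow])
  have hss : s * s = ‖q‖ := Real.mul_self_sqrt (norm_nonneg _)
  have hsum : Summable fun S : Finset ℕ => ∏ i ∈ S, s ^ (i + 1) :=
    summable_finsetProd_of_summable_nonneg (fun i => by positivity)
      ((summable_nat_add_iff 1).2 (summable_geometric_of_lt_one hs0 hs1))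
  refine Summable.of_norm_bounded (g := fun p : ℕ × Finset ℕ => s ^ p.1 * ∏ i ∈ p.2, s ^ (i + 1))
    ((summable_geometric_of_lt_one hs0 hs1).mul_of_nonneg hsum
      (fun _ => by positivity) (fun _ => by positivity)) ?_
  rintro ⟨m, S⟩
  rw [hookTerm]
  split_ifs with hS
  · have h1 : ‖∏ i ∈ S, q ^ (i + 1)‖ = (∏ i ∈ S, s ^ (i + 1)) * ∏ i ∈ S, s ^ (i + 1) := by
      rw [norm_prod, ← prod_mul_distrib]
      exact prod_congr rfl fun i _ => by rw [norm_pow, ← hss, mul_pow]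
    rw [h1]
    refine mul_le_mul_of_nonneg_right ?_ (by positivity)
    rw [prod_pow_eq_pow_sum]
    refine pow_le_pow_of_le_one hs0 hs1.le ?_
    have : m + (h - j - 1) + 1 ≤ ∑ e ∈ S, (e + 1) :=
      single_le_sum_of_canonicallyOrdered (f := fun e => e + 1) hS.1
    exact (by omega : m ≤ m + (h - j - 1) + 1).trans this
  · rw [norm_zero]
    positivity

lemma tsum_hookTerm_column (h : ℕ) (q : ℂ) (j : ℕ) {n : ℕ} {S : Finset ℕ}
    (hS : S ∈ strictFinsets n) :
    ∑' m, hookTerm h q j m S = (#{m ∈ range (n + 1) | HasHook h j m S} : ℂ) * q ^ n := by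
  rw [mem_strictFinsets] at hS
  rw [tsum_eq_sum (s := range (n + 1)), card_filter, Nat.cast_sum, sum_mul]
  · refine sum_congr rfl fun m _ => ?_
    rw [hookTerm, prod_pow_eq_pow_sum, hS]
    simp
  · intro m hm
    rw [hookTerm, if_neg]
    intro hc
    have : m + (h - j - 1) + 1 ≤ ∑ e ∈ S, (e + 1) :=
      single_le_sum_of_canonicallyOrdered (f := fun e => e + 1) hc.1
    rw [hS] at this
    rw [mem_range] at hm
    omega

end Analysis

/-- The generating function identity for `b̃_h(q)`:
`b̃_h(q) = (−q;q)_∞ Σ_{j=0}^{⌈h/2⌉−1} q^{h+j(j−1)/2} C(h−j−1,j)_q Σ_{m≥0} q^{(j+1)m}/(−q^{m+1};q)_{h−j}`. -/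
theorem btilde_eq (h : ℕ) (hh : 1 ≤ h) (q : ℂ) (hq : ‖q‖ < 1) :
    btilde h q = negqInf q *
      ∑ j ∈ Finset.range ((h + 1) / 2),
        q ^ (h + j * (j - 1) / 2) * qBinom (h - j - 1) j q *
          ∑' m : ℕ, q ^ ((j + 1) * m) / qPoch (-(q ^ (m + 1))) q (h - j) := by
  have hsum : ∀ j, Summable fun S => ∑' m, hookTerm h q j m S := fun j =>
    (summable_hookTerm hq h j).prod_symm.prod
  have hfib : ∀ n, ∑' S : (fun S : Finset ℕ => ∑ e ∈ S, (e + 1)) ⁻¹' {n},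
      ∑ j ∈ range ((h + 1) / 2), ∑' m, hookTerm h q j m S = (hookDistinct h n : ℂ) * q ^ n := by
    intro n
    have hset : (fun S : Finset ℕ => ∑ e ∈ S, (e + 1)) ⁻¹' {n} = ↑(strictFinsets n) := by
      ext S
      simp [mem_strictFinsets]
    rw [hset, Finset.tsum_subtype' (strictFinsets n)
      (fun S => ∑ j ∈ range ((h + 1) / 2), ∑' m, hookTerm h q j m S), hookDistinct_eq,
      Nat.cast_sum, sum_mul]
    refine sum_congr rfl fun S hS => ?_
    rw [Nat.cast_sum, sum_mul]
    exact sum_congr rfl fun j _ => tsum_hookTerm_column h q j hS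
  have hall : Summable fun S => ∑ j ∈ range ((h + 1) / 2), ∑' m, hookTerm h q j m S :=
    summable_sum fun j _ => hsum j
  rw [btilde, ← tsum_congr hfib,
    (hall.hasSum.tsum_fiberwise (fun S : Finset ℕ => ∑ e ∈ S, (e + 1))).tsum_eq,
    Summable.tsum_finsetSum fun j _ => hsum j, mul_sum]
  refine sum_congr rfl fun j hj => ?_
  rw [mem_range] at hj
  rw [Summable.tsum_comm (f := hookTerm h q j) (summable_hookTerm hq h j), ← tsum_mul_left, ← tsum_mul_left]
  exact tsum_congr fun m => tsum_hookTerm hq (by omega) m
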